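/- Let N be an integer with N ≡ 5 (mod 7) and N ≥ 32478. Then the sequence B_N̄ ends after exactly 2N+4547 terms: B_N̄(n) is defined for all n ≤ 2N+4547 and B_N̄(2N+4547) ≤ 0, so B_N̄(2N+4548) is undefined. -/

import Mathlib

/-- `IsBBarSeqTo N m f` says that `f` realizes the sequence generated by the
`B`-recurrence from initial conditions `⟨0̄; 1,2,...,N⟩`, defined through index `m`:
`f n = 0` for `n ≤ 0`, `f n = n` for `1 ≤ n ≤ N`, and for `N < n ≤ m` the previous
three terms are `≥ 1` and the `B`-recurrence holds (nonpositive arguments give `0`). -/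
def IsBBarSeqTo (N m : ℤ) (f : ℤ → ℤ) : Prop :=
  (∀ n : ℤ, n ≤ 0 → f n = 0) ∧
  (∀ n : ℤ, 1 ≤ n → n ≤ N → f n = n) ∧
  (∀ n : ℤ, N < n → n ≤ m →
    1 ≤ f (n - 1) ∧ 1 ≤ f (n - 2) ∧ 1 ≤ f (n - 3) ∧
    f n = f (n - f (n - 1)) + f (n - f (n - 2)) + f (n - f (n - 3)))

namespace BBar

/-! Write `N = 7 * K + 5`. Every value of the sequence, and every index at which it has to be
evaluated, is an affine function `a * K + b` of `K`, represented below by the pair `(a, b)`. -/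

/-- Coefficients of the values at `N + e` for `1 ≤ e ≤ 66`. -/
def burstAfterN : List (ℤ × ℤ) :=
  [(0, 6), (7, 6), (7, 7), (7, 8), (0, 9), (7, 9), (7, 10), (7, 11), (0, 12), (7, 12), (7, 13),
   (7, 14), (0, 15), (7, 15), (7, 16), (0, 17), (7, 18), (0, 18), (7, 18), (7, 20), (7, 21),
   (0, 22), (0, 21), (14, 21), (14, 15), (0, 9), (0, 18), (14, 30), (14, 33), (7, 14), (0, 22),
   (7, 35), (7, 40), (7, 18), (0, 27), (0, 36), (7, 42), (14, 20), (7, 9), (0, 39), (7, 43),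
   (7, 49), (7, 13), (0, 42), (7, 45), (7, 52), (0, 16), (7, 44), (7, 52), (7, 32), (0, 40),
   (7, 44), (0, 55), (14, 34), (7, 21), (0, 46), (7, 54), (7, 65), (0, 25), (0, 38), (0, 58),
   (28, 71), (14, 24), (7, 9), (0, 61), (0, 71)]

/-- Coefficients of the values at `2 * N + c` for `1 ≤ c ≤ 117`. -/
def burstAfterTwoN : List (ℤ × ℤ) :=
  [(7, 3), (7, 8), (7, 14), (14, 15), (14, 7), (7, 12), (7, 17), (7, 18), (21, 9), (14, 5),
   (7, 19), (7, 20), (14, 25), (14, 9), (7, 21), (7, 23), (7, 28), (21, 11), (7, 7), (7, 20),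
   (14, 27), (14, 35), (7, 17), (7, 21), (0, 27), (30, 82), (22, 16), (7, 3), (0, 22), (14, 53),
   (28, 49), (14, 5), (0, 38), (14, 46), (14, 49), (0, 7), (14, 54), (28, 49), (14, 5), (0, 45),
   (14, 53), (14, 56), (0, 7), (14, 55), (28, 49), (14, 6), (0, 53), (7, 54), (21, 65),
   (14, 15), (7, 52), (0, 56), (21, 66), (7, 17), (23, 68), (0, 42), (14, 66), (7, 25),
   (14, 40), (0, 73), (14, 69), (14, 35), (14, 44), (0, 74), (0, 78), (23, 80), (29, 2),
   (14, 2), (0, 77), (15, 80), (7, 82), (14, 2), (7, 82), (14, 86), (7, 86), (14, 4), (7, 85),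
   (14, 89), (7, 89), (14, 7), (7, 88), (14, 92), (7, 92), (7, 10), (7, 13), (28, 165),
   (21, 100), (0, 7), (14, 92), (7, 100), (14, 20), (7, 94), (14, 94), (0, 103), (23, 73),
   (15, 14), (7, 3), (7, 107), (7, 9), (35, 102), (14, 7), (0, 205), (14, 15), (14, 117),
   (0, 107), (16, 156), (15, 3), (7, 3), (7, 3), (0, 228), (21, 128), (21, 16), (14, -103),
   (0, 227), (15, 215), (7, 232), (14, -208)]

/-- Coefficients of the values at `2 * N + c` for `549 ≤ c ≤ 768`. -/
def burst549 : List (ℤ × ℤ) :=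
  [(7, 115), (14, 114), (7, 894), (14, 564), (7, 118), (7, 113), (14, 452), (7, 1014),
   (14, 123), (7, 115), (14, 456), (7, 1018), (7, -325), (7, -323), (28, 762), (14, 137),
   (14, 747), (0, 439), (7, 682), (21, -304), (14, 138), (7, 340), (14, 479), (7, 550),
   (14, 374), (14, 348), (7, 462), (0, 571), (14, 377), (14, 356), (7, 463), (0, 454),
   (28, 461), (21, 262), (14, -200), (0, 794), (7, 798), (14, 393), (21, -193), (7, 5),
   (7, 801), (14, 396), (7, 12), (21, 228), (14, 293), (7, 314), (7, 315), (7, 605), (14, 585),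
   (14, 320), (7, 317), (7, 609), (14, 589), (7, 33), (14, 609), (7, 613), (7, 15), (14, 612),
   (14, 613), (0, 18), (7, 25), (28, 832), (14, 300), (14, 545), (0, 401), (14, 266), (7, 743),
   (21, 446), (7, 245), (7, 265), (14, 751), (7, 394), (21, 395), (7, 240), (0, 14), (42, 997),
   (28, 358), (14, 545), (0, 92), (7, 641), (21, 198), (14, 546), (7, 95), (0, 103), (21, 847),
   (28, 520), (7, 545), (14, 16), (7, 634), (0, 744), (22, 633), (14, 16), (7, 539), (0, 643),
   (29, 725), (21, 21), (7, 8), (7, 3), (14, 741), (14, 654), (0, 658), (16, 59), (15, 9),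
   (7, 3), (14, 241), (14, 519), (7, 573), (14, 651), (14, 179), (7, 509), (7, 669), (14, 655),
   (7, 25), (21, 114), (7, 21), (14, 885), (14, 95), (7, 584), (14, 661), (14, 615), (7, 85),
   (7, 681), (7, 73), (28, 835), (7, 9), (28, 325), (7, 3), (7, 677), (0, 690), (21, 690),
   (21, 10), (14, 2), (0, 689), (15, 692), (7, 694), (14, 2), (7, 694), (14, 698), (7, 698),
   (14, 4), (7, 697), (14, 701), (7, 701), (14, 7), (7, 700), (14, 704), (7, 704), (7, 10),
   (14, 9), (7, 1398), (14, 711), (7, 13), (7, 8), (14, 704), (7, 1413), (14, 18), (7, 10),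
   (14, 708), (7, 1417), (7, -682), (7, -680), (28, 1158), (14, 209), (14, 966), (0, 514),
   (7, 811), (21, -232), (14, 210), (7, 433), (0, 525), (21, 945), (28, 232), (7, 293),
   (0, 436), (21, 698), (14, 805), (14, -80), (0, 816), (7, 735), (21, 744), (21, -71), (7, 5),
   (0, 7), (28, 183), (14, 923), (7, 735), (0, 9), (14, 744), (28, 757), (21, -67), (0, 5),
   (0, 9), (42, 927), (42, 1680), (7, 735), (7, 15), (7, 753), (14, 762), (14, 748), (7, 15),
   (14, 276), (14, 604), (7, 645), (0, 758), (14, 280), (21, 612), (14, 494), (0, 758),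
   (16, 328), (15, 277), (7, 3), (7, 3), (0, 1530), (21, 779), (21, 16), (14, -754), (0, 1529),
   (15, 1424), (7, 1534), (14, -1510)]

/-- Coefficients of the values at `2 * N + c` for `3804 ≤ c ≤ 3844`. -/
def burst3804 : List (ℤ × ℤ) :=
  [(7, 766), (14, 765), (7, 6102), (14, 3819), (7, 769), (7, 764), (14, 3056), (7, 6873),
   (14, 774), (7, 766), (14, 3060), (7, 6877), (7, -2278), (7, -2276), (28, 4854), (14, 881),
   (14, 4746), (0, 2950), (14, 1518), (7, 3927), (21, 3083), (7, 2225), (7, -84), (14, 520),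
   (28, 4723), (14, 3881), (0, 3320), (14, 425), (7, 3947), (21, 3402), (7, 3316), (14, -99),
   (0, 4472), (14, 3850), (14, 3324), (14, -96), (0, 4472), (16, 4349), (15, 3861), (7, 3),
   (0, 7)]

/-- Coefficients of the values at `2 * N + c` for `4478 ≤ c ≤ 4547`. -/
def burst4478 : List (ℤ × ℤ) :=
  [(7, 12), (14, 20), (7, 8963), (14, 4479), (7, 14), (14, 24), (7, 8967), (7, 6), (21, 644),
   (14, -4467), (0, 13454), (7, 8), (14, 4503), (21, -4457), (7, 4496), (7, 6), (14, 10),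
   (7, 8999), (14, 4504), (7, 8), (14, 14), (7, 9003), (7, 10), (14, 4508), (7, -4480),
   (14, 10334), (7, 9001), (14, 4511), (7, -4480), (21, -1855), (14, 1294), (7, 3228),
   (7, 3229), (7, 4520), (14, 2587), (14, 3234), (7, 3231), (7, 4524), (14, 2591), (7, 1946),
   (14, 4524), (7, 4528), (7, 15), (7, 17), (28, 5864), (14, 654), (14, 5223), (0, 3881),
   (7, 3890), (21, 97), (21, 744), (0, 646), (15, -81), (7, 3), (14, 657), (7, 3889), (7, 8428),
   (7, 658), (28, -2667), (14, -3878), (0, 12313), (14, 664), (14, 4553), (0, 3894), (14, 4542),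
   (0, 669), (16, 4543), (16, -102), (15, -82), (0, 0)]

/-- Coefficients of the value at `N + e`, for `1 ≤ e ≤ N`. -/
def firstPart (e : ℤ) : ℤ × ℤ :=
  if e ≤ 66 then burstAfterN.getD (e - 1).toNat (0, 0) else
    let m := (e - 67) / 7
    [(14, 73 + 2 * m), (14, 12 + m), (7, 3), (0, 72 + 7 * m), (7, 77 + 7 * m), (7, 79 + 7 * m),
      (0, 7)].getD ((e - 67) % 7).toNat (0, 0)

/-- Coefficients of the value at `2 * N + d`, for `d ≤ 0` in the periodic part of the range
described by `firstPart`. -/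
def firstPartEnd (d : ℤ) : ℤ × ℤ :=
  let t := (d + 1) / 7
  [(16, 55 + 2 * t), (15, 3 + t), (7, 3), (7, 9 + 7 * t), (14, 14 + 7 * t), (14, 16 + 7 * t),
    (0, 7)].getD ((d + 1) % 7).toNat (0, 0)

/-- Coefficients of the value at `2 * N + A + 4 + i`, for `i ≥ 0`, in a phase with parameter `A`. -/
def secondPartPhase (A i : ℤ) : ℤ × ℤ :=
  let j := i / 4
  [(7, 2 * A + 4 + 3 * j), (14, A + 17 + 3 * j), (7, 2 * A + 8 + 3 * j),
    (14, 22 - 2 * A + 3 * j)].getD (i % 4).toNat (0, 0)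

/-- Coefficients of the value at `2 * N + 3845 + i`, for `0 ≤ i ≤ 632`. -/
def quadraticPhase (i : ℤ) : ℤ × ℤ :=
  let j := i / 7
  [(28 + 14 * j, 4477 + 1154 * j + j * j), (28 + 14 * j, 456 + 553 * j + j * (j - 1) / 2),
    (0, 4472), (16, -123 + 2 * j), (15, -86 + j), (7, 3), (0, 7)].getD (i % 7).toNat (0, 0)

/-- Coefficients of the value at `2 * N + c`, for `1 ≤ c ≤ 4547`. -/
def secondPart (c : ℤ) : ℤ × ℤ :=
  if c ≤ 117 then burstAfterTwoN.getD (c - 1).toNat (0, 0)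
  else if c ≤ 548 then secondPartPhase 114 (c - 118)
  else if c ≤ 768 then burst549.getD (c - 549).toNat (0, 0)
  else if c ≤ 3803 then secondPartPhase 765 (c - 769)
  else if c ≤ 3844 then burst3804.getD (c - 3804).toNat (0, 0)
  else if c ≤ 4477 then quadraticPhase (c - 3845)
  else burst4478.getD (c - 4478).toNat (0, 0)

/-- The value at `K` of the affine function with coefficients `v`. -/
def eval (K : ℤ) (v : ℤ × ℤ) : ℤ := v.1 * K + v.2

/-- The sequence generated from the initial conditions with `N = 7 * K + 5`. -/
def seq (K n : ℤ) : ℤ :=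
  if n ≤ 0 then 0
  else if n ≤ 7 * K + 5 then n
  else if n ≤ 14 * K + 10 then eval K (firstPart (n - (7 * K + 5)))
  else eval K (secondPart (n - (14 * K + 10)))

/-- Coefficients of `seq K (p * K + q)`, valid for every `K ≥ 4639`, when they can be found. -/
def symbolicSeq (p q : ℤ) : Option (ℤ × ℤ) :=
  if p ≤ 0 then
    if p * 4639 + q ≤ 0 then some (0, 0)
    else if p = 0 then if q ≤ 32478 then some (0, q) else none
    else none
  else if p = 7 then
    if q ≤ 5 then if -32473 < q then some (7, q) else none
    else if q ≤ 32478 then some (firstPart (q - 5)) else none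
  else if p = 14 then
    if q ≤ 10 then if -30000 < q then some (firstPartEnd (q - 10)) else none
    else some (secondPart (q - 10))
  else none

theorem firstPart_periodic (m r : ℤ) (hm : 0 ≤ m) (h₀ : 0 ≤ r) (h₁ : r < 7) :
    firstPart (67 + 7 * m + r) =
      [(14, 73 + 2 * m), (14, 12 + m), (7, 3), (0, 72 + 7 * m), (7, 77 + 7 * m), (7, 79 + 7 * m),
        (0, 7)].getD r.toNat (0, 0) := by
  have h₂ : (67 + 7 * m + r - 67) / 7 = m := by omega
  have h₃ : (67 + 7 * m + r - 67) % 7 = r := by omega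
  simp only [firstPart, h₂, h₃]
  rw [if_neg (by omega)]

theorem eval_firstPart_end {K d : ℤ} (hd : 72 ≤ 7 * K + d) :
    eval K (firstPart (7 * K + 5 + d)) = eval K (firstPartEnd d) := by
  obtain ⟨t, r, h₀, h₁, rfl⟩ : ∃ t r : ℤ, 0 ≤ r ∧ r < 7 ∧ d = 7 * t + r - 1 :=
    ⟨(d + 1) / 7, (d + 1) % 7, by omega, by omega, by omega⟩
  have h₂ : (7 * t + r - 1 + 1) / 7 = t := by omega
  have h₃ : (7 * t + r - 1 + 1) % 7 = r := by omega
  rw [show 7 * K + 5 + (7 * t + r - 1) = 67 + 7 * (K - 9 + t) + r by ring,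
    firstPart_periodic _ _ (by omega) h₀ h₁]
  simp only [firstPartEnd, h₂, h₃]
  interval_cases r <;> simp [eval] <;> ring

/-- Whether the affine function with coefficients `v` is visibly positive for `K ≥ 4639`. -/
def isPos (v : ℤ × ℤ) : Bool := decide (0 ≤ v.1) && decide (1 ≤ v.1 * 4639 + v.2)

/-- Whether the recurrence, with its positivity requirements, is verified symbolically at the
index `p * K + q`. -/
def verifies (p q : ℤ) : Bool :=
  match symbolicSeq p (q - 1), symbolicSeq p (q - 2), symbolicSeq p (q - 3), symbolicSeq p q with
  | some u, some v, some w, some x =>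
    isPos u && isPos v && isPos w &&
      match symbolicSeq (p - u.1) (q - u.2), symbolicSeq (p - v.1) (q - v.2),
        symbolicSeq (p - w.1) (q - w.2) with
      | some a, some b, some c =>
        decide (x.1 = a.1 + b.1 + c.1) && decide (x.2 = a.2 + b.2 + c.2)
      | _, _, _ => false
  | _, _, _, _ => false

/-- Whether the recurrence is verified symbolically at `p * K + s + i` for `1 ≤ i ≤ n`. -/
def verifiesUpTo (p s : ℤ) : ℕ → Bool
  | 0 => true
  | n + 1 => verifies p (s + (n + 1 : ℕ)) && verifiesUpTo p s n

theorem verifies_of_verifiesUpTo {p s : ℤ} {n : ℕ} (h : verifiesUpTo p s n = true) {q : ℤ}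
    (h₁ : s < q) (h₂ : q ≤ s + n) : verifies p q = true := by
  induction n with
  | zero => omega
  | succ n ih =>
    rw [verifiesUpTo, Bool.and_eq_true] at h
    rcases h₂.lt_or_eq with h₂ | rfl
    · exact ih h.2 (by push_cast at h₂; omega)
    · exact h.1

theorem seq_of_symbolicSeq {K : ℤ} (hK : 4639 ≤ K) {p q : ℤ} {v : ℤ × ℤ}
    (h : symbolicSeq p q = some v) : seq K (p * K + q) = eval K v := by
  unfold symbolicSeq at h
  split_ifs at h with h₀ h₁ h₂ h₃ h₄ h₅ h₆ h₇ h₈ h₉ h₁₀ <;> cases h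
  · rw [seq, if_pos (by nlinarith)]
    simp [eval]
  · subst h₂
    rw [seq, if_neg (by omega), if_pos (by omega)]
    simp [eval]
  · subst h₄
    rw [seq, if_neg (by omega), if_pos (by omega)]
    simp [eval]
  · subst h₄
    rw [seq, if_neg (by omega), if_neg (by omega), if_pos (by omega)]
    congr 2
    ring
  · subst h₈
    rw [← eval_firstPart_end (by omega), seq, if_neg (by omega), if_neg (by omega),
      if_pos (by omega)]
    congr 2
    ring
  · subst h₈
    rw [seq, if_neg (by omega), if_neg (by omega), if_neg (by omega)]
    congr 2
    ring

theorem one_le_eval_of_isPos {K : ℤ} (hK : 4639 ≤ K) {v : ℤ × ℤ} (h : isPos v = true) :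
    1 ≤ eval K v := by
  simp only [isPos, Bool.and_eq_true, decide_eq_true_eq] at h
  unfold eval
  nlinarith

/-- The recurrence at `n`, with its positivity requirements. -/
def RecurrenceAt (f : ℤ → ℤ) (n : ℤ) : Prop :=
  1 ≤ f (n - 1) ∧ 1 ≤ f (n - 2) ∧ 1 ≤ f (n - 3) ∧
    f n = f (n - f (n - 1)) + f (n - f (n - 2)) + f (n - f (n - 3))

theorem recurrenceAt_of_verifies {K : ℤ} (hK : 4639 ≤ K) {p q : ℤ}
    (h : verifies p q = true) : RecurrenceAt (seq K) (p * K + q) := by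
  unfold verifies at h
  split at h
  · rename_i u v w x hu hv hw hx
    simp only [Bool.and_eq_true] at h
    obtain ⟨⟨⟨pu, pv⟩, pw⟩, h⟩ := h
    split at h
    · rename_i a b c ha hb hc
      simp only [Bool.and_eq_true, decide_eq_true_eq] at h
      have back {v a : ℤ × ℤ} (ha : symbolicSeq (p - v.1) (q - v.2) = some a) :
          seq K (p * K + q - eval K v) = eval K a := by
        rw [← seq_of_symbolicSeq hK ha]
        congr 1
        unfold eval
        ring
      have shift (i : ℤ) : p * K + q - i = p * K + (q - i) := add_sub_assoc ..
      unfold RecurrenceAt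
      rw [shift 1, shift 2, shift 3, seq_of_symbolicSeq hK hu, seq_of_symbolicSeq hK hv,
        seq_of_symbolicSeq hK hw, seq_of_symbolicSeq hK hx, back ha, back hb, back hc]
      refine ⟨one_le_eval_of_isPos hK pu, one_le_eval_of_isPos hK pv,
        one_le_eval_of_isPos hK pw, ?_⟩
      simp only [eval, h.1, h.2]
      ring
    · simp at h
  · simp at h

theorem verifiesUpTo_firstPart : verifiesUpTo 7 5 73 = true := by
  decide +kernel

theorem verifiesUpTo_secondPart :
    (verifiesUpTo 14 10 121 && verifiesUpTo 14 (10 + 545) 227 &&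
      verifiesUpTo 14 (10 + 3800) 51 && verifiesUpTo 14 (10 + 4467) 80) = true := by
  decide +kernel

theorem RecurrenceAt.of_values {f : ℤ → ℤ} {n x u v w a b c : ℤ} (hx : f n = x)
    (hu : f (n - 1) = u) (hv : f (n - 2) = v) (hw : f (n - 3) = w) (ha : f (n - u) = a)
    (hb : f (n - v) = b) (hc : f (n - w) = c) (pu : 1 ≤ u) (pv : 1 ≤ v) (pw : 1 ≤ w)
    (h : x = a + b + c) : RecurrenceAt f n := by
  subst hu hv hw ha hb hc hx
  exact ⟨pu, pv, pw, h⟩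

theorem seq_of_nonpos {K n : ℤ} (h : n ≤ 0) : seq K n = 0 := by
  rw [seq, if_pos h]

theorem seq_of_le {K n : ℤ} (h₀ : 0 ≤ n) (h : n ≤ 7 * K + 5) : seq K n = n := by
  rcases h₀.eq_or_lt with rfl | h₀
  · exact seq_of_nonpos le_rfl
  · rw [seq, if_neg h₀.not_ge, if_pos h]

theorem seq_firstPart {K e : ℤ} (h₀ : 1 ≤ e) (h : e ≤ 7 * K + 5) :
    seq K (7 * K + 5 + e) = eval K (firstPart e) := by
  rw [seq, if_neg (by omega), if_neg (by omega), if_pos (by omega), add_sub_cancel_left]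

theorem seq_secondPart {K c : ℤ} (hK : 0 ≤ K) (hc : 1 ≤ c) :
    seq K (14 * K + 10 + c) = eval K (secondPart c) := by
  rw [seq, if_neg (by omega), if_neg (by omega), if_neg (by omega), add_sub_cancel_left]

section FirstPart

variable {K m i : ℤ}

theorem seq_firstPart_periodic {r : ℤ} (hm : 0 ≤ m) (h₀ : 0 ≤ r) (h₁ : r < 7)
    (hi : i = 7 * K + 5 + (67 + 7 * m + r)) (h : i ≤ 14 * K + 10) :
    seq K i = eval K
      ([(14, 73 + 2 * m), (14, 12 + m), (7, 3), (0, 72 + 7 * m), (7, 77 + 7 * m), (7, 79 + 7 * m),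
        (0, 7)].getD r.toNat (0, 0)) := by
  rw [hi, ← firstPart_periodic m r hm h₀ h₁, seq_firstPart (by omega) (by omega)]

theorem seq_firstPart_zero (hm : 0 ≤ m) (hi : i = 7 * K + 72 + 7 * m) (h : i ≤ 14 * K + 10) :
    seq K i = 14 * K + (73 + 2 * m) :=
  seq_firstPart_periodic (r := 0) hm (by omega) (by omega) (by omega) h

theorem seq_firstPart_one (hm : 0 ≤ m) (hi : i = 7 * K + 73 + 7 * m) (h : i ≤ 14 * K + 10) :
    seq K i = 14 * K + (12 + m) :=
  seq_firstPart_periodic (r := 1) hm (by omega) (by omega) (by omega) h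

theorem seq_firstPart_two (hm : 0 ≤ m) (hi : i = 7 * K + 74 + 7 * m) (h : i ≤ 14 * K + 10) :
    seq K i = 7 * K + 3 :=
  seq_firstPart_periodic (r := 2) hm (by omega) (by omega) (by omega) h

theorem seq_firstPart_three (hm : 0 ≤ m) (hi : i = 7 * K + 75 + 7 * m) (h : i ≤ 14 * K + 10) :
    seq K i = 72 + 7 * m :=
  (seq_firstPart_periodic (r := 3) hm (by omega) (by omega) (by omega) h).trans
    (by simp [eval])

theorem seq_firstPart_four (hm : 0 ≤ m) (hi : i = 7 * K + 76 + 7 * m) (h : i ≤ 14 * K + 10) :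
    seq K i = 7 * K + (77 + 7 * m) :=
  seq_firstPart_periodic (r := 4) hm (by omega) (by omega) (by omega) h

theorem seq_firstPart_five (hm : 0 ≤ m) (hi : i = 7 * K + 77 + 7 * m) (h : i ≤ 14 * K + 10) :
    seq K i = 7 * K + (79 + 7 * m) :=
  seq_firstPart_periodic (r := 5) hm (by omega) (by omega) (by omega) h

theorem seq_firstPart_six (hm : 0 ≤ m) (hi : i = 7 * K + 78 + 7 * m) (h : i ≤ 14 * K + 10) :
    seq K i = 7 :=
  (seq_firstPart_periodic (r := 6) hm (by omega) (by omega) (by omega) h).trans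
    (by simp [eval])

theorem seq_add_six (hK : 0 ≤ K) (hi : i = 7 * K + 6) : seq K i = 6 := by
  rw [hi, show 7 * K + 6 = 7 * K + 5 + 1 by ring, seq_firstPart le_rfl (by omega)]
  simp [eval, firstPart, burstAfterN]

theorem recurrenceAt_firstPart_periodic {r : ℤ} (hm : 1 ≤ m) (h₀ : 0 ≤ r) (h₁ : r < 7)
    (h : 62 + 7 * m + r ≤ 7 * K) : RecurrenceAt (seq K) (7 * K + 72 + 7 * m + r) := by
  have hm' : 0 ≤ m := by omega
  have hm'' : 0 ≤ m - 1 := by omega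
  have hr : r = 0 ∨ r = 1 ∨ r = 2 ∨ r = 3 ∨ r = 4 ∨ r = 5 ∨ r = 6 := by omega
  rcases hr with rfl | rfl | rfl | rfl | rfl | rfl | rfl
  · apply RecurrenceAt.of_values (seq_firstPart_zero hm' _ _) (seq_firstPart_six hm'' _ _)
      (seq_firstPart_five hm'' _ _) (seq_firstPart_four hm'' _ _) (seq_firstPart_zero hm'' _ _)
      (seq_of_le _ _) (seq_of_le _ _) <;> omega
  · apply RecurrenceAt.of_values (seq_firstPart_one hm' _ _) (seq_firstPart_zero hm' _ _)
      (seq_firstPart_six hm'' _ _) (seq_firstPart_five hm'' _ _) (seq_of_nonpos _)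
      (seq_firstPart_one hm'' _ _) (seq_of_le _ _) <;> omega
  · apply RecurrenceAt.of_values (seq_firstPart_two hm' _ _) (seq_firstPart_one hm' _ _)
      (seq_firstPart_zero hm' _ _) (seq_firstPart_six hm'' _ _) (seq_of_nonpos _)
      (seq_of_nonpos _) (seq_firstPart_two hm'' _ _) <;> omega
  · apply RecurrenceAt.of_values (seq_firstPart_three hm' _ _) (seq_firstPart_two hm' _ _)
      (seq_firstPart_one hm' _ _) (seq_firstPart_zero hm' _ _) (seq_of_le _ _)
      (seq_of_nonpos _) (seq_of_nonpos _) <;> omega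
  · apply RecurrenceAt.of_values (seq_firstPart_four hm' _ _) (seq_firstPart_three hm' _ _)
      (seq_firstPart_two hm' _ _) (seq_firstPart_one hm' _ _) (seq_of_le _ _)
      (seq_of_le _ _) (seq_of_nonpos _) <;> omega
  · apply RecurrenceAt.of_values (seq_firstPart_five hm' _ _) (seq_firstPart_four hm' _ _)
      (seq_firstPart_three hm' _ _) (seq_firstPart_two hm' _ _) (seq_of_nonpos _)
      (seq_of_le _ _) (seq_of_le _ _) <;> omega
  · apply RecurrenceAt.of_values (seq_firstPart_six hm' _ _) (seq_firstPart_five hm' _ _)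
      (seq_firstPart_four hm' _ _) (seq_firstPart_three hm' _ _) (seq_of_nonpos _)
      (seq_of_le _ _) (seq_add_six _ _) <;> omega

end FirstPart

section SecondPartPhase

variable {K A j i : ℤ}

theorem secondPart_eq_secondPartPhase (hA : A = 114 ∨ A = 765) (h₀ : 0 ≤ i)
    (h : i ≤ 4 * A - 26) : secondPart (A + 4 + i) = secondPartPhase A i := by
  unfold secondPart
  rcases hA with rfl | rfl
  · rw [if_neg (by omega), if_pos (by omega)]
    congr 1
    ring
  · rw [if_neg (by omega), if_neg (by omega), if_neg (by omega), if_pos (by omega)]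
    congr 1
    ring

theorem seq_secondPartPhase {r : ℤ} (hK : 0 ≤ K) (hA : A = 114 ∨ A = 765) (hj : 0 ≤ j)
    (hj' : j ≤ A - 8) (h₀ : 0 ≤ r) (h₁ : r < 4) (hi : i = 14 * K + A + 14 + 4 * j + r) :
    seq K i = eval K
      ([(7, 2 * A + 4 + 3 * j), (14, A + 17 + 3 * j), (7, 2 * A + 8 + 3 * j),
        (14, 22 - 2 * A + 3 * j)].getD r.toNat (0, 0)) := by
  have h₂ : (4 * j + r) / 4 = j := by omega
  have h₃ : (4 * j + r) % 4 = r := by omega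
  rw [hi, show 14 * K + A + 14 + 4 * j + r = 14 * K + 10 + (A + 4 + (4 * j + r)) by ring,
    seq_secondPart hK (by omega), secondPart_eq_secondPartPhase hA (by omega) (by omega)]
  simp only [secondPartPhase, h₂, h₃]

theorem recurrenceAt_secondPartPhase {r : ℤ} (hK : 4639 ≤ K) (hA : A = 114 ∨ A = 765)
    (hj : 1 ≤ j) (hj' : j ≤ A - 8) (h₀ : 0 ≤ r) (h₁ : r < 4) :
    RecurrenceAt (seq K) (14 * K + A + 14 + 4 * j + r) := by
  have value₀ {j i : ℤ} (h₀ : 0 ≤ j) (h : j ≤ A - 8) (hi : i = 14 * K + A + 14 + 4 * j) :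
      seq K i = 7 * K + (2 * A + 4 + 3 * j) :=
    seq_secondPartPhase (r := 0) (by omega) hA h₀ h (by omega) (by omega) (by omega)
  have value₁ {j i : ℤ} (h₀ : 0 ≤ j) (h : j ≤ A - 8) (hi : i = 14 * K + A + 15 + 4 * j) :
      seq K i = 14 * K + (A + 17 + 3 * j) :=
    seq_secondPartPhase (r := 1) (by omega) hA h₀ h (by omega) (by omega) (by omega)
  have value₂ {j i : ℤ} (h₀ : 0 ≤ j) (h : j ≤ A - 8) (hi : i = 14 * K + A + 16 + 4 * j) :
      seq K i = 7 * K + (2 * A + 8 + 3 * j) :=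
    seq_secondPartPhase (r := 2) (by omega) hA h₀ h (by omega) (by omega) (by omega)
  have value₃ {j i : ℤ} (h₀ : 0 ≤ j) (h : j ≤ A - 8) (hi : i = 14 * K + A + 17 + 4 * j) :
      seq K i = 14 * K + (22 - 2 * A + 3 * j) :=
    seq_secondPartPhase (r := 3) (by omega) hA h₀ h (by omega) (by omega) (by omega)
  have h₂ : 0 ≤ j := by omega
  have h₃ : 0 ≤ j - 1 := by omega
  have h₄ : j - 1 ≤ A - 8 := by omega
  have hr : r = 0 ∨ r = 1 ∨ r = 2 ∨ r = 3 := by omega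
  rcases hr with rfl | rfl | rfl | rfl
  · apply RecurrenceAt.of_values (value₀ h₂ hj' _) (value₃ h₃ h₄ _) (value₂ h₃ h₄ _)
      (value₁ h₃ h₄ _) (seq_of_le _ _) (seq_of_le _ _) (seq_of_le _ _) <;> omega
  · apply RecurrenceAt.of_values (value₁ h₂ hj' _) (value₀ h₂ hj' _) (value₃ h₃ h₄ _)
      (value₂ h₃ h₄ _) (seq_of_le _ _) (seq_of_le _ _) (seq_of_le _ _) <;> omega
  · apply RecurrenceAt.of_values (value₂ h₂ hj' _) (value₁ h₂ hj' _) (value₀ h₂ hj' _)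
      (value₃ h₃ h₄ _) (seq_of_le _ _) (seq_of_le _ _) (seq_of_le _ _) <;> omega
  · apply RecurrenceAt.of_values (value₃ h₂ hj' _) (value₂ h₂ hj' _) (value₁ h₂ hj' _)
      (value₀ h₂ hj' _) (seq_of_le _ _) (seq_of_le _ _) (seq_of_le _ _) <;> omega

end SecondPartPhase

section QuadraticPhase

variable {K j i : ℤ}

theorem secondPart_eq_quadraticPhase (h₀ : 0 ≤ i) (h : i ≤ 632) :
    secondPart (3845 + i) = quadraticPhase i := by
  rw [secondPart, if_neg (by omega), if_neg (by omega), if_neg (by omega), if_neg (by omega),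
    if_neg (by omega), if_pos (by omega), add_sub_cancel_left]

theorem seq_quadraticPhase {r : ℤ} (hK : 0 ≤ K) (hj : 0 ≤ j) (hj' : j ≤ 89) (h₀ : 0 ≤ r)
    (h₁ : r < 7) (hi : i = 14 * K + 3855 + 7 * j + r) :
    seq K i = eval K
      ([(28 + 14 * j, 4477 + 1154 * j + j * j), (28 + 14 * j, 456 + 553 * j + j * (j - 1) / 2),
        (0, 4472), (16, -123 + 2 * j), (15, -86 + j), (7, 3), (0, 7)].getD r.toNat (0, 0)) := by
  have h₂ : (7 * j + r) / 7 = j := by omega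
  have h₃ : (7 * j + r) % 7 = r := by omega
  rw [hi, show 14 * K + 3855 + 7 * j + r = 14 * K + 10 + (3845 + (7 * j + r)) by ring,
    seq_secondPart hK (by omega), secondPart_eq_quadraticPhase (by omega) (by omega)]
  simp only [quadraticPhase, h₂, h₃]

theorem recurrenceAt_quadraticPhase {r : ℤ} (hK : 4639 ≤ K) (hj : 1 ≤ j) (hj' : j ≤ 88)
    (h₀ : 0 ≤ r) (h₁ : r < 7) : RecurrenceAt (seq K) (14 * K + 3855 + 7 * j + r) := by
  have value₀ {j i : ℤ} (h₀ : 0 ≤ j) (h : j ≤ 89) (hi : i = 14 * K + 3855 + 7 * j) :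
      seq K i = (28 + 14 * j) * K + (4477 + 1154 * j + j * j) :=
    seq_quadraticPhase (r := 0) (by omega) h₀ h (by omega) (by omega) (by omega)
  have value₁ {j i : ℤ} (h₀ : 0 ≤ j) (h : j ≤ 89) (hi : i = 14 * K + 3856 + 7 * j) :
      seq K i = (28 + 14 * j) * K + (456 + 553 * j + j * (j - 1) / 2) :=
    seq_quadraticPhase (r := 1) (by omega) h₀ h (by omega) (by omega) (by omega)
  have value₂ {j i : ℤ} (h₀ : 0 ≤ j) (h : j ≤ 89) (hi : i = 14 * K + 3857 + 7 * j) :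
      seq K i = 4472 :=
    (seq_quadraticPhase (r := 2) (by omega) h₀ h (by omega) (by omega) (by omega)).trans
      (by simp [eval])
  have value₃ {j i : ℤ} (h₀ : 0 ≤ j) (h : j ≤ 89) (hi : i = 14 * K + 3858 + 7 * j) :
      seq K i = 16 * K + (-123 + 2 * j) :=
    seq_quadraticPhase (r := 3) (by omega) h₀ h (by omega) (by omega) (by omega)
  have value₄ {j i : ℤ} (h₀ : 0 ≤ j) (h : j ≤ 89) (hi : i = 14 * K + 3859 + 7 * j) :
      seq K i = 15 * K + (-86 + j) :=
    seq_quadraticPhase (r := 4) (by omega) h₀ h (by omega) (by omega) (by omega)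
  have value₅ {j i : ℤ} (h₀ : 0 ≤ j) (h : j ≤ 89) (hi : i = 14 * K + 3860 + 7 * j) :
      seq K i = 7 * K + 3 :=
    seq_quadraticPhase (r := 5) (by omega) h₀ h (by omega) (by omega) (by omega)
  have value₆ {j i : ℤ} (h₀ : 0 ≤ j) (h : j ≤ 89) (hi : i = 14 * K + 3861 + 7 * j) :
      seq K i = 7 :=
    (seq_quadraticPhase (r := 6) (by omega) h₀ h (by omega) (by omega) (by omega)).trans
      (by simp [eval])
  have h₂ : 0 ≤ j := by omega
  have h₃ : j ≤ 89 := by omega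
  have h₄ : 0 ≤ j - 1 := by omega
  have h₅ : j - 1 ≤ 89 := by omega
  have large : 28 * K ≤ (28 + 14 * j) * K := by nlinarith
  have square : 0 ≤ j * j := by nlinarith
  have triangle : 0 ≤ j * (j - 1) := by nlinarith
  have large_pred : (28 + 14 * (j - 1)) * K = (28 + 14 * j) * K - 14 * K := by ring
  have square_pred : (j - 1) * (j - 1) = j * j - 2 * j + 1 := by ring
  have triangle_pred : (j - 1) * (j - 1 - 1) = j * (j - 1) - 2 * (j - 1) := by ring
  have hm : 0 ≤ 540 + j := by omega
  have hm' : 0 ≤ K - 98 + j := by omega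
  have hr : r = 0 ∨ r = 1 ∨ r = 2 ∨ r = 3 ∨ r = 4 ∨ r = 5 ∨ r = 6 := by omega
  rcases hr with rfl | rfl | rfl | rfl | rfl | rfl | rfl
  · apply RecurrenceAt.of_values (value₀ h₂ h₃ _) (value₆ h₄ h₅ _) (value₅ h₄ h₅ _)
      (value₄ h₄ h₅ _) (value₀ h₄ h₅ _) (seq_firstPart_zero hm _ _) (seq_of_nonpos _) <;> omega
  · apply RecurrenceAt.of_values (value₁ h₂ h₃ _) (value₀ h₂ h₃ _) (value₆ h₄ h₅ _)
      (value₅ h₄ h₅ _) (seq_of_nonpos _) (value₁ h₄ h₅ _) (seq_firstPart_one hm _ _) <;> omega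
  · apply RecurrenceAt.of_values (value₂ h₂ h₃ _) (value₁ h₂ h₃ _) (value₀ h₂ h₃ _)
      (value₆ h₄ h₅ _) (seq_of_nonpos _) (seq_of_nonpos _) (value₂ h₄ h₅ _) <;> omega
  · apply RecurrenceAt.of_values (value₃ h₂ h₃ _) (value₂ h₂ h₃ _) (value₁ h₂ h₃ _)
      (value₀ h₂ h₃ _) (seq_firstPart_zero hm' _ _) (seq_of_nonpos _) (seq_of_nonpos _) <;> omega
  · apply RecurrenceAt.of_values (value₄ h₂ h₃ _) (value₃ h₂ h₃ _) (value₂ h₂ h₃ _)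
      (value₁ h₂ h₃ _) (seq_of_nonpos _) (seq_firstPart_one hm' _ _) (seq_of_nonpos _) <;> omega
  · apply RecurrenceAt.of_values (value₅ h₂ h₃ _) (value₄ h₂ h₃ _) (value₃ h₂ h₃ _)
      (value₂ h₂ h₃ _) (seq_of_nonpos _) (seq_of_nonpos _) (seq_firstPart_two hm' _ _) <;> omega
  · apply RecurrenceAt.of_values (value₆ h₂ h₃ _) (value₅ h₂ h₃ _) (value₄ h₂ h₃ _)
      (value₃ h₂ h₃ _) (seq_firstPart_six hm _ _) (seq_of_nonpos _) (seq_of_nonpos _) <;> omega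

end QuadraticPhase

theorem recurrenceAt_firstPart {K e : ℤ} (hK : 4639 ≤ K) (h₀ : 1 ≤ e) (h : e ≤ 7 * K + 5) :
    RecurrenceAt (seq K) (7 * K + 5 + e) := by
  by_cases he : e ≤ 73
  · rw [add_assoc]
    exact recurrenceAt_of_verifies hK
      (verifies_of_verifiesUpTo verifiesUpTo_firstPart (by omega) (by push_cast; omega))
  · rw [show 7 * K + 5 + e = 7 * K + 72 + 7 * ((e - 67) / 7) + (e - 67) % 7 by omega]
    exact recurrenceAt_firstPart_periodic (by omega) (by omega) (by omega) (by omega)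

theorem recurrenceAt_secondPart {K c : ℤ} (hK : 4639 ≤ K) (h₀ : 1 ≤ c) (h : c ≤ 4547) :
    RecurrenceAt (seq K) (14 * K + 10 + c) := by
  have phase (A : ℤ) (hA : A = 114 ∨ A = 765) (h₀ : A + 8 ≤ c) (h₁ : c ≤ 5 * A - 25) :
      RecurrenceAt (seq K) (14 * K + 10 + c) := by
    rw [show 14 * K + 10 + c = 14 * K + A + 14 + 4 * ((c - A - 4) / 4) + (c - A - 4) % 4 by omega]
    exact recurrenceAt_secondPartPhase hK hA (by omega) (by omega) (by omega) (by omega)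
  have verified (s : ℤ) (n : ℕ) (hs : verifiesUpTo 14 (10 + s) n = true) (h₀ : s < c)
      (h₁ : c ≤ s + n) : RecurrenceAt (seq K) (14 * K + 10 + c) := by
    rw [add_assoc]
    exact recurrenceAt_of_verifies hK (verifies_of_verifiesUpTo hs (by omega) (by omega))
  have checks := verifiesUpTo_secondPart
  simp only [Bool.and_eq_true] at checks
  obtain ⟨⟨⟨check₁, check₂⟩, check₃⟩, check₄⟩ := checks
  by_cases h₁ : c ≤ 121
  · exact verified 0 121 check₁ (by omega) (by push_cast; omega)
  by_cases h₂ : c ≤ 545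
  · exact phase 114 (by omega) (by omega) (by omega)
  by_cases h₃ : c ≤ 772
  · exact verified 545 227 check₂ (by omega) (by push_cast; omega)
  by_cases h₄ : c ≤ 3800
  · exact phase 765 (by omega) (by omega) (by omega)
  by_cases h₅ : c ≤ 3851
  · exact verified 3800 51 check₃ (by omega) (by push_cast; omega)
  by_cases h₆ : c ≤ 4467
  · rw [show 14 * K + 10 + c = 14 * K + 3855 + 7 * ((c - 3845) / 7) + (c - 3845) % 7 by omega]
    exact recurrenceAt_quadraticPhase hK (by omega) (by omega) (by omega) (by omega)
  · exact verified 4467 80 check₄ (by omega) (by push_cast; omega)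

end BBar

theorem BbarN_ends_mod5 (N : ℤ) (hmod : N % 7 = 5) (hN : 32478 ≤ N) :
    ∃ f, IsBBarSeqTo N (2 * N + 4547) f ∧ f (2 * N + 4547) ≤ 0 := by
  obtain ⟨K, rfl⟩ : ∃ K, N = 7 * K + 5 := ⟨N / 7, by omega⟩
  have hK : 4639 ≤ K := by omega
  refine ⟨BBar.seq K, ⟨fun n => BBar.seq_of_nonpos, fun n h₀ h => BBar.seq_of_le (by omega) h,
    fun n h₀ h => ?_⟩, ?_⟩
  · change BBar.RecurrenceAt (BBar.seq K) n
    by_cases hn : n ≤ 14 * K + 10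
    · rw [← add_sub_cancel (7 * K + 5) n]
      exact BBar.recurrenceAt_firstPart hK (by omega) (by omega)
    · rw [← add_sub_cancel (14 * K + 10) n]
      exact BBar.recurrenceAt_secondPart hK (by omega) (by omega)
  · rw [show 2 * (7 * K + 5) + 4547 = 14 * K + 10 + 4547 by ring,
      BBar.seq_secondPart (by omega) (by omega)]
    simp [BBar.eval, BBar.secondPart, BBar.burst4478]
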